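/- As p → +∞ one has r_p^{2/(p−1)} → t̄ / e^{t̄/(2(t̄+√e))} (≈ 0.67). -/

import Mathlib

open Real MeasureTheory Set Filter

noncomputable section

/-- The radial energy functional for the Lane–Emden problem on the unit ball of `ℝ²`
(written in polar coordinates; the common factor `2π` is dropped). -/
def radialEnergy (p : ℝ) (v : ℝ → ℝ) : ℝ :=
  (1 / 2) * (∫ r in (0:ℝ)..1, (deriv v r) ^ 2 * r)
    - (1 / (p + 1)) * ∫ r in (0:ℝ)..1, |v r| ^ (p + 1) * r

/-- The Nehari identity `∫_B |∇v⁺|² = ∫_B |v⁺|^{p+1}` for the positive part,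
written in polar coordinates. -/
def nehariPos (p : ℝ) (v : ℝ → ℝ) : Prop :=
  (∫ r in (0:ℝ)..1, (if 0 < v r then (deriv v r) ^ 2 * r else 0))
    = ∫ r in (0:ℝ)..1, (max (v r) 0) ^ (p + 1) * r

/-- The Nehari identity `∫_B |∇v⁻|² = ∫_B |v⁻|^{p+1}` for the negative part,
written in polar coordinates. -/
def nehariNeg (p : ℝ) (v : ℝ → ℝ) : Prop :=
  (∫ r in (0:ℝ)..1, (if v r < 0 then (deriv v r) ^ 2 * r else 0))
    = ∫ r in (0:ℝ)..1, (max (-v r) 0) ^ (p + 1) * r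

/-- A family `p ↦ u p` (for `p > 1`) of least energy nodal radial solutions of the
Lane–Emden problem `−Δu = |u|^{p−1}u` in the unit ball `B ⊆ ℝ²`, `u = 0` on `∂B`,
described through the radial profile `u p : ℝ → ℝ`.  `rp p ∈ (0,1)` is the nodal
radius, `sp p ∈ (rp p, 1)` is a radius where `u p` attains `‖(u p)⁺‖_∞`; the solution
is negative in the inner nodal region (`u p 0 < 0`), attains `-‖(u p)⁻‖_∞` at `0`,
and minimizes the energy among radial members of the nodal Nehari set. -/
structure LaneEmdenFamily where
  u : ℝ → ℝ → ℝ
  rp : ℝ → ℝ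
  sp : ℝ → ℝ
  smooth : ∀ p, 1 < p → ContDiffOn ℝ 2 (u p) (Icc (0:ℝ) 1)
  ode : ∀ p, 1 < p → ∀ r ∈ Ioo (0:ℝ) 1,
    -deriv (deriv (u p)) r - deriv (u p) r / r = |u p r| ^ (p - 1) * u p r
  derivAtZero : ∀ p, 1 < p → deriv (u p) 0 = 0
  boundary : ∀ p, 1 < p → u p 1 = 0
  center_neg : ∀ p, 1 < p → u p 0 < 0
  min_at_zero : ∀ p, 1 < p → ∀ r ∈ Icc (0:ℝ) 1, u p 0 ≤ u p r
  rp_mem : ∀ p, 1 < p → rp p ∈ Ioo (0:ℝ) 1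
  rp_zero : ∀ p, 1 < p → u p (rp p) = 0
  neg_in : ∀ p, 1 < p → ∀ r ∈ Ico (0:ℝ) (rp p), u p r < 0
  pos_out : ∀ p, 1 < p → ∀ r ∈ Ioo (rp p) 1, 0 < u p r
  sp_mem : ∀ p, 1 < p → sp p ∈ Ioo (rp p) 1
  sp_max : ∀ p, 1 < p → ∀ r ∈ Icc (0:ℝ) 1, u p r ≤ u p (sp p)
  least_energy : ∀ p, 1 < p → ∀ v : ℝ → ℝ,
    ContDiffOn ℝ 1 v (Icc (0:ℝ) 1) → v 1 = 0 →
    (∃ r ∈ Ioo (0:ℝ) 1, 0 < v r) → (∃ r ∈ Ioo (0:ℝ) 1, v r < 0) →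
    nehariPos p v → nehariNeg p v →
    radialEnergy p (u p) ≤ radialEnergy p v

/-- `ε_p⁺`, defined by `(ε_p⁺)⁻² = p · ‖u_p⁺‖_∞^{p−1} = p · u_p(s_p)^{p−1}`. -/
def epsP (F : LaneEmdenFamily) (p : ℝ) : ℝ :=
  1 / Real.sqrt (p * F.u p (F.sp p) ^ (p - 1))

/-- `ε_p⁻`, defined by `(ε_p⁻)⁻² = p · ‖u_p⁻‖_∞^{p−1} = p · |u_p(0)|^{p−1}`. -/
def epsM (F : LaneEmdenFamily) (p : ℝ) : ℝ :=
  1 / Real.sqrt (p * (-F.u p 0) ^ (p - 1))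

/-- `y` is a positive solution on `s`, with derivative `g`, of the Emden–Fowler equation
`y'' + e^{2t} y^p = 0`. -/
structure IsEmdenFowler (p : ℝ) (y g : ℝ → ℝ) (s : Set ℝ) : Prop where
  convex : Convex ℝ s
  continuousOn : ContinuousOn y s
  continuousOn_deriv : ContinuousOn g s
  hasDerivAt : ∀ t ∈ interior s, HasDerivAt y (g t) t
  hasDerivAt_deriv : ∀ t ∈ interior s, HasDerivAt g (-(exp (2 * t) * y t ^ p)) t
  nonneg : ∀ t ∈ s, 0 ≤ y t
  pos : ∀ t ∈ interior s, 0 < y t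

/-- The energy `y'² / 2 + e^{2t} y^{p+1} / (p+1)` of an Emden–Fowler solution. -/
def efEnergy (p : ℝ) (y g : ℝ → ℝ) (t : ℝ) : ℝ :=
  g t ^ 2 / 2 + exp (2 * t) * y t ^ (p + 1) / (p + 1)

namespace IsEmdenFowler

theorem monotoneOn_of_hasDerivAt {f f' : ℝ → ℝ} {s : Set ℝ} (hs : Convex ℝ s)
    (hc : ContinuousOn f s) (hd : ∀ t ∈ interior s, HasDerivAt f (f' t) t)
    (h : ∀ t ∈ interior s, 0 ≤ f' t) : MonotoneOn f s :=
  monotoneOn_of_hasDerivWithinAt_nonneg hs hc (fun t ht => (hd t ht).hasDerivWithinAt) h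

variable {p : ℝ} {y g : ℝ → ℝ} {s : Set ℝ}

theorem mono (h : IsEmdenFowler p y g s) {s' : Set ℝ} (hs' : Convex ℝ s') (hss : s' ⊆ s) :
    IsEmdenFowler p y g s' where
  convex := hs'
  continuousOn := h.continuousOn.mono hss
  continuousOn_deriv := h.continuousOn_deriv.mono hss
  hasDerivAt t ht := h.hasDerivAt t (interior_mono hss ht)
  hasDerivAt_deriv t ht := h.hasDerivAt_deriv t (interior_mono hss ht)
  nonneg t ht := h.nonneg t (hss ht)
  pos t ht := h.pos t (interior_mono hss ht)

theorem antitoneOn_deriv (h : IsEmdenFowler p y g s) : AntitoneOn g s := by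
  have := monotoneOn_of_hasDerivAt (f := fun t => -g t) h.convex h.continuousOn_deriv.neg
    (fun t ht => (h.hasDerivAt_deriv t ht).neg) (fun t ht => by
      have := h.pos t ht
      rw [neg_neg]; positivity)
  intro a ha b hb hab
  have := this ha hb hab
  simpa using this

theorem sub_le (h : IsEmdenFowler p y g s) {a b : ℝ} (ha : a ∈ s) (hb : b ∈ s) (hab : a ≤ b) :
    y b - y a ≤ g a * (b - a) := by
  have hI : Icc a b ⊆ s := h.convex.ordConnected.out ha hb
  have h' := h.mono (convex_Icc a b) hI
  have hm := monotoneOn_of_hasDerivAt (f := fun t => g a * t - y t) h'.convex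
    ((continuousOn_const.mul continuousOn_id).sub h'.continuousOn)
    (fun t ht => ((hasDerivAt_id t).const_mul (g a)).sub (h'.hasDerivAt t ht)) (fun t ht => by
      have := h.antitoneOn_deriv ha (hI (interior_subset ht)) (interior_subset ht).1
      linarith)
  have := hm (left_mem_Icc.2 hab) (right_mem_Icc.2 hab) hab
  simp only at this
  linarith

theorem le_sub (h : IsEmdenFowler p y g s) {a b : ℝ} (ha : a ∈ s) (hb : b ∈ s) (hab : a ≤ b) :
    g b * (b - a) ≤ y b - y a := by
  have hI : Icc a b ⊆ s := h.convex.ordConnected.out ha hb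
  have h' := h.mono (convex_Icc a b) hI
  have hm := monotoneOn_of_hasDerivAt (f := fun t => y t - g b * t) h'.convex
    (h'.continuousOn.sub (continuousOn_const.mul continuousOn_id))
    (fun t ht => (h'.hasDerivAt t ht).sub ((hasDerivAt_id t).const_mul (g b))) (fun t ht => by
      have := h.antitoneOn_deriv (hI (interior_subset ht)) hb (interior_subset ht).2
      linarith)
  have := hm (left_mem_Icc.2 hab) (right_mem_Icc.2 hab) hab
  simp only at this
  linarith

theorem hasDerivAt_exp_two_mul (t : ℝ) :
    HasDerivAt (fun t => exp (2 * t)) (2 * exp (2 * t)) t := by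
  have := ((hasDerivAt_id t).const_mul 2).exp
  simpa [mul_comm] using this

theorem continuousOn_rpow (h : IsEmdenFowler p y g s) {q : ℝ} (hq : 0 < q) :
    ContinuousOn (fun t => exp (2 * t) * y t ^ q) s := by
  refine ContinuousOn.mul (by fun_prop) (h.continuousOn.rpow_const fun t _ => Or.inr hq.le)

theorem hasDerivAt_energy (h : IsEmdenFowler p y g s) (hp : 1 < p) {t : ℝ} (ht : t ∈ interior s) :
    HasDerivAt (efEnergy p y g) (2 / (p + 1) * (exp (2 * t) * y t ^ p * y t)) t := by
  have hy := h.pos t ht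
  have h1 := ((h.hasDerivAt_deriv t ht).pow 2).div_const 2
  have h2 := (h.hasDerivAt t ht).rpow_const (p := p + 1) (Or.inl hy.ne')
  have h3 := (((hasDerivAt_exp_two_mul t).mul h2).div_const (p + 1))
  have h4 := h1.add h3
  refine h4.congr_deriv ?_
  have e1 : y t ^ (p + 1) = y t ^ p * y t := by rw [rpow_add hy, rpow_one]
  have e2 : p + 1 - 1 = p := by ring
  have : p + 1 ≠ 0 := by linarith
  rw [e1, e2]
  field_simp
  push_cast
  ring

theorem continuousOn_energy (h : IsEmdenFowler p y g s) (hp : 1 < p) :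
    ContinuousOn (efEnergy p y g) s :=
  ((h.continuousOn_deriv.pow 2).div_const 2).add
    ((h.continuousOn_rpow (by linarith)).div_const _)

theorem energy_sub_le (h : IsEmdenFowler p y g s) (hp : 1 < p) {a b m : ℝ}
    (ha : a ∈ s) (hb : b ∈ s) (hab : a ≤ b) (hm : ∀ t ∈ Icc a b, y t ≤ m) :
    efEnergy p y g b - efEnergy p y g a ≤ 2 / (p + 1) * (m * (g a - g b)) := by
  have hI : Icc a b ⊆ s := h.convex.ordConnected.out ha hb
  have h' := h.mono (convex_Icc a b) hI
  have hp1 : 0 < 2 / (p + 1) := by have : 0 < p + 1 := by linarith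
                                   positivity
  have hmono := monotoneOn_of_hasDerivAt
    (f := fun t => 2 / (p + 1) * (m * -g t) - efEnergy p y g t) h'.convex
    ((continuousOn_const.mul (continuousOn_const.mul h'.continuousOn_deriv.neg)).sub
      (h'.continuousOn_energy hp))
    (fun t ht => (((h'.hasDerivAt_deriv t ht).neg.const_mul m).const_mul (2 / (p + 1))).sub
      (h'.hasDerivAt_energy hp ht)) (fun t ht => by
      have h1 := h'.pos t ht
      have h2 := hm t (interior_subset ht)
      have : 0 ≤ 2 / (p + 1) * (exp (2 * t) * y t ^ p * (m - y t)) := by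
        have := sub_nonneg.2 h2
        positivity
      linarith)
  have := hmono (left_mem_Icc.2 hab) (right_mem_Icc.2 hab) hab
  simp only at this
  linarith

theorem le_energy_sub (h : IsEmdenFowler p y g s) (hp : 1 < p) {a b m c : ℝ}
    (ha : a ∈ s) (hb : b ∈ s) (hab : a ≤ b) (hm : ∀ t ∈ Icc a b, m + c * (t - a) ≤ y t) :
    2 / (p + 1) * (m * (g a - g b) + c * (y b - y a - g b * (b - a))) ≤
      efEnergy p y g b - efEnergy p y g a := by
  have hI : Icc a b ⊆ s := h.convex.ordConnected.out ha hb
  have h' := h.mono (convex_Icc a b) hI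
  have hp1 : 0 < 2 / (p + 1) := by have : 0 < p + 1 := by linarith
                                   positivity
  have hmono := monotoneOn_of_hasDerivAt
    (f := fun t => efEnergy p y g t - 2 / (p + 1) * (m * -g t + c * (y t - g t * (t - a))))
    h'.convex
    ((h'.continuousOn_energy hp).sub (continuousOn_const.mul
      ((continuousOn_const.mul h'.continuousOn_deriv.neg).add (continuousOn_const.mul
        (h'.continuousOn.sub (h'.continuousOn_deriv.mul (by fun_prop)))))))
    (fun t ht => (h'.hasDerivAt_energy hp ht).sub
      ((((h'.hasDerivAt_deriv t ht).neg.const_mul m).add (((h'.hasDerivAt t ht).sub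
      ((h'.hasDerivAt_deriv t ht).mul ((hasDerivAt_id t).sub_const a))).const_mul c)).const_mul
        (2 / (p + 1)))) (fun t ht => by
      have h1 := h'.pos t ht
      have h2 := hm t (interior_subset ht)
      have : 0 ≤ 2 / (p + 1) * (exp (2 * t) * y t ^ p * (y t - (m + c * (t - a)))) := by
        have := sub_nonneg.2 h2
        positivity
      simp only [id]
      linarith)
  have := hmono (left_mem_Icc.2 hab) (right_mem_Icc.2 hab) hab
  simp only at this
  linarith

/-- On an interval where `y` increases from `0` to its maximum, the mass of `e^{2t} y^p`
lies on average within `1 / 2` of the maximum point. -/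
theorem left_slope_le (h : IsEmdenFowler p y g s) (hp : 1 < p) {a b : ℝ}
    (ha : a ∈ s) (hb : b ∈ s) (hab : a ≤ b) (hya : y a = 0) (hgb : g b = 0) :
    g a * (b - a - 1 / 2) ≤ y b := by
  have hI : Icc a b ⊆ s := h.convex.ordConnected.out ha hb
  have h' := h.mono (convex_Icc a b) hI
  have hmono := monotoneOn_of_hasDerivAt
    (f := fun t => g t * (b - t) + y t - g t / 2 + exp (2 * t) * y t ^ p * ((b - t) / 2))
    h'.convex
    ((((h'.continuousOn_deriv.mul (by fun_prop)).add h'.continuousOn).sub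
      (h'.continuousOn_deriv.div_const 2)).add
      ((h'.continuousOn_rpow (by linarith)).mul (by fun_prop)))
    (fun t ht => ((((h'.hasDerivAt_deriv t ht).mul ((hasDerivAt_id t).const_sub b)).add
      (h'.hasDerivAt t ht)).sub ((h'.hasDerivAt_deriv t ht).div_const 2)).add
      (((hasDerivAt_exp_two_mul t).mul ((h'.hasDerivAt t ht).rpow_const (p := p)
        (Or.inl (h'.pos t ht).ne'))).mul (((hasDerivAt_id t).const_sub b).div_const 2)))
    (fun t ht => by
      have h1 := h'.pos t ht
      have h2 : 0 ≤ b - t := sub_nonneg.2 (interior_subset ht).2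
      have h3 : 0 ≤ g t := by
        have := h.antitoneOn_deriv (hI (interior_subset ht)) hb (interior_subset ht).2
        linarith
      have : 0 ≤ exp (2 * t) * (g t * p * y t ^ (p - 1)) * ((b - t) / 2) := by positivity
      simp only [id, Pi.mul_apply]
      linarith)
  have := hmono (left_mem_Icc.2 hab) (right_mem_Icc.2 hab) hab
  simp only [hya, hgb, zero_rpow (show p ≠ 0 by linarith)] at this
  linarith

/-- On an interval where `y` decreases to `0`, the deficit `|y'(b)| (b - a) - y a`
is controlled. -/
theorem right_slope_le (h : IsEmdenFowler p y g s) (hp : 1 < p) {a b : ℝ}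
    (ha : a ∈ s) (hb : b ∈ s) (hab : a ≤ b) (hyb : y b = 0) (hga : g a ≤ 0) :
    (-g b * (b - a) - y a) * (-g b - g a - 4 * y a / (p + 1)) ≤
      2 * y a * (-g b + g a) / (p + 1) := by
  have hI : Icc a b ⊆ s := h.convex.ordConnected.out ha hb
  have h' := h.mono (convex_Icc a b) hI
  have hp1 : 0 < p + 1 := by linarith
  have hEb : efEnergy p y g b = g b ^ 2 / 2 := by
    simp [efEnergy, hyb, zero_rpow hp1.ne']
  have hmono := monotoneOn_of_hasDerivAt
    (f := fun t => (t - a) * (g b ^ 2 / 2 - efEnergy p y g t)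
      - ((-g b - g a) / 2 * (y t - g b * t) + y a / (p + 1) * g t
        - 2 * y a / (p + 1) * (y t - g t * (t - a))))
    h'.convex
    (ContinuousOn.sub (ContinuousOn.mul (by fun_prop) (continuousOn_const.sub
      (h'.continuousOn_energy hp))) (((continuousOn_const.mul
        (h'.continuousOn.sub (by fun_prop))).add (continuousOn_const.mul
          h'.continuousOn_deriv)).sub (continuousOn_const.mul (h'.continuousOn.sub
            (h'.continuousOn_deriv.mul (by fun_prop))))))
    (fun t ht => (((hasDerivAt_id t).sub_const a).mul
      ((h'.hasDerivAt_energy hp ht).const_sub (g b ^ 2 / 2))).sub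
      (((((h'.hasDerivAt t ht).sub ((hasDerivAt_id t).const_mul (g b))).const_mul
        ((-g b - g a) / 2)).add ((h'.hasDerivAt_deriv t ht).const_mul (y a / (p + 1)))).sub
        (((h'.hasDerivAt t ht).sub ((h'.hasDerivAt_deriv t ht).mul
          ((hasDerivAt_id t).sub_const a))).const_mul (2 * y a / (p + 1)))))
    (fun t ht => by
      have htI := interior_subset ht
      have h1 := h'.pos t ht
      have h2 : 0 ≤ t - a := sub_nonneg.2 htI.1
      have h3 := h.antitoneOn_deriv ha (hI htI) htI.1
      have h4 := h.antitoneOn_deriv (hI htI) hb htI.2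
      have h5 : y t ≤ y a := by
        have := h.sub_le ha (hI htI) htI.1
        nlinarith
      have e1 : y t ^ (p + 1) = y t ^ p * y t := by rw [rpow_add h1, rpow_one]
      have k1 : 0 ≤ (g t - g b) * (g a - g t) / 2 := by
        have := sub_nonneg.2 h3
        have := sub_nonneg.2 h4
        positivity
      have k2 : 0 ≤ exp (2 * t) * y t ^ p / (p + 1) * (y a - y t) * (1 + 2 * (t - a)) := by
        have := sub_nonneg.2 h5
        positivity
      simp only [id, efEnergy, e1]
      have hh : exp (2 * t) * (y t ^ p * y t) / (p + 1)
        = exp (2 * t) * y t ^ p / (p + 1) * y t := by ring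
      have hh2 : 2 / (p + 1) * (exp (2 * t) * y t ^ p * y t)
        = 2 * (exp (2 * t) * y t ^ p / (p + 1) * y t) := by ring
      rw [hh, hh2]
      have hh3 : y a / (p + 1) * -(exp (2 * t) * y t ^ p)
        = - (exp (2 * t) * y t ^ p / (p + 1) * y a) := by ring
      have hh4 : 2 * y a / (p + 1) * (g t - (-(exp (2 * t) * y t ^ p) * (t - a) + g t * 1))
        = 2 * (exp (2 * t) * y t ^ p / (p + 1) * y a) * (t - a) := by ring
      rw [hh3, hh4]
      linarith)
  have := hmono (left_mem_Icc.2 hab) (right_mem_Icc.2 hab) hab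
  simp only [hyb, hEb] at this
  have e : 2 * y a * (-g b + g a) / (p + 1) -
      (-g b * (b - a) - y a) * (-g b - g a - 4 * y a / (p + 1)) = 
      2 * (y a / (p + 1) * (g a - g b) + 2 * y a / (p + 1) * (- g b * (b - a) - y a))
       + (-g b * (b - a) - y a) * (g a + g b) := by ring
  rw [← sub_nonneg, e]
  have : 2 * y a / (p + 1) = 2 * (y a / (p + 1)) := by ring
  simp only [this] at *
  linarith


theorem le_of_monotoneOn_Iic {f : ℝ → ℝ} {T l a : ℝ} (hf : MonotoneOn f (Iic T))
    (hl : Tendsto f atBot (nhds l)) (ha : a ≤ T) : l ≤ f a :=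
  le_of_tendsto hl ((eventually_le_atBot a).mono fun _ ht => hf (ht.trans ha) ha ht)

theorem le_of_monotoneOn_Iio {f : ℝ → ℝ} {T l a : ℝ} (hf : MonotoneOn f (Iio T))
    (hl : Tendsto f atBot (nhds l)) (ha : a < T) : l ≤ f a :=
  le_of_tendsto hl ((eventually_le_atBot a).mono fun _ ht => hf (ht.trans_lt ha) ha ht)

section HalfLine

variable {T M : ℝ}

theorem deriv_nonpos (h : IsEmdenFowler p y g (Iic T)) (hg : Tendsto g atBot (nhds 0))
    {a : ℝ} (ha : a ≤ T) : g a ≤ 0 := by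
  have := le_of_monotoneOn_Iic (f := fun t => -g t) h.antitoneOn_deriv.neg hg.neg ha
  linarith

theorem le_limit (h : IsEmdenFowler p y g (Iic T)) (hg : Tendsto g atBot (nhds 0))
    (hy : Tendsto y atBot (nhds M)) {a : ℝ} (ha : a ≤ T) : y a ≤ M := by
  refine ge_of_tendsto hy ((eventually_le_atBot a).mono fun t ht => ?_)
  have h1 := h.sub_le (mem_Iic.2 (ht.trans ha)) ha ht
  have h2 := h.deriv_nonpos hg (ht.trans ha)
  nlinarith

theorem tendsto_energy (hp : 1 < p) (hg : Tendsto g atBot (nhds 0))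
    (hy : Tendsto y atBot (nhds M)) : Tendsto (efEnergy p y g) atBot (nhds 0) := by
  have he : Tendsto (fun t : ℝ => exp (2 * t)) atBot (nhds 0) :=
    tendsto_exp_atBot.comp (tendsto_id.const_mul_atBot two_pos)
  have h1 := ((hg.pow 2).div_const 2).add
    ((he.mul (hy.rpow_const (p := p + 1) (Or.inr (by linarith)))).div_const (p + 1))
  simp only [ne_eq, OfNat.ofNat_ne_zero, not_false_eq_true, zero_pow, zero_div, zero_mul,
    add_zero] at h1
  exact h1

theorem neg_mul_le_energy (h : IsEmdenFowler p y g (Iic T)) (hp : 1 < p)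
    (hg : Tendsto g atBot (nhds 0)) (hy : Tendsto y atBot (nhds M)) {a : ℝ} (ha : a ≤ T) :
    2 / (p + 1) * (y a * -g a) ≤ efEnergy p y g a := by
  have hp1 : 0 < p + 1 := by linarith
  have hmono := monotoneOn_of_hasDerivAt
    (f := fun t => efEnergy p y g t + 2 / (p + 1) * (y t * g t)) h.convex
    ((h.continuousOn_energy hp).add (continuousOn_const.mul
      (h.continuousOn.mul h.continuousOn_deriv)))
    (fun t ht => (h.hasDerivAt_energy hp ht).add
      (((h.hasDerivAt t ht).mul (h.hasDerivAt_deriv t ht)).const_mul (2 / (p + 1))))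
    (fun t ht => by
      have : 0 ≤ 2 / (p + 1) * (g t * g t) := mul_nonneg (by positivity) (mul_self_nonneg _)
      linarith)
  have hlim := (tendsto_energy hp hg hy).add ((hy.mul hg).const_mul (2 / (p + 1)))
  have := le_of_monotoneOn_Iic hmono hlim ha
  simp only [mul_zero, add_zero] at this
  linarith

theorem energy_le_neg_mul (h : IsEmdenFowler p y g (Iic T)) (hp : 1 < p)
    (hg : Tendsto g atBot (nhds 0)) (hy : Tendsto y atBot (nhds M)) {a : ℝ} (ha : a ≤ T) :
    efEnergy p y g a ≤ 2 / (p + 1) * (M * -g a) := by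
  have hp1 : 0 < p + 1 := by linarith
  have hmono := monotoneOn_of_hasDerivAt
    (f := fun t => 2 / (p + 1) * (M * -g t) - efEnergy p y g t) h.convex
    ((continuousOn_const.mul (continuousOn_const.mul h.continuousOn_deriv.neg)).sub
      (h.continuousOn_energy hp))
    (fun t ht => (((h.hasDerivAt_deriv t ht).neg.const_mul M).const_mul (2 / (p + 1))).sub
      (h.hasDerivAt_energy hp ht))
    (fun t ht => by
      have h1 := h.pos t ht
      have h2 := sub_nonneg.2 (h.le_limit hg hy (mem_Iic.1 (interior_subset ht)))
      have : 0 ≤ 2 / (p + 1) * (exp (2 * t) * y t ^ p * (M - y t)) := by positivity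
      linarith)
  have hlim := (((hg.neg).const_mul M).const_mul (2 / (p + 1))).sub (tendsto_energy hp hg hy)
  have := le_of_monotoneOn_Iic hmono hlim ha
  simp only [neg_zero, mul_zero, sub_zero] at this
  linarith

/-- Comparison with the Liouville bubble. -/
theorem bubble_le (h : IsEmdenFowler p y g (Iic T)) (hp : 1 < p) (hM : 0 < M)
    (hg : Tendsto g atBot (nhds 0)) (hy : Tendsto y atBot (nhds M)) {a : ℝ} (ha : a < T) :
    M * (1 + (p - 1) * g a / (4 * y a)) ^ (2 / (p - 1)) ≤ y a ∨
      1 + (p - 1) * g a / (4 * y a) < 0 := by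
  have hp1 : 0 < p + 1 := by linarith
  have hI : interior (Iic T) = Iio T := interior_Iic
  obtain ⟨q, rfl⟩ : ∃ q, p = 2 * q + 1 := ⟨(p - 1) / 2, by ring⟩
  have hq : 0 < q := by linarith
  have h' := h.mono (convex_Iio T) Iio_subset_Iic_self
  have hpos : ∀ t ∈ Iio T, 0 < y t := fun t ht => h.pos t (by rwa [hI])
  have hmono := monotoneOn_of_hasDerivAt
    (f := fun t => -q * (y t ^ (-q - 1) * g t) - 2 * y t ^ (-q)) h'.convex
    ((continuousOn_const.mul ((h'.continuousOn.rpow_const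
      fun t ht => Or.inl (hpos t ht).ne').mul h'.continuousOn_deriv)).sub
      (continuousOn_const.mul (h'.continuousOn.rpow_const
      fun t ht => Or.inl (hpos t ht).ne')))
    (fun t ht => ((((h'.hasDerivAt t ht).rpow_const (p := -q - 1)
      (Or.inl (h'.pos t ht).ne')).mul (h'.hasDerivAt_deriv t ht)).const_mul (-q)).sub
      (((h'.hasDerivAt t ht).rpow_const (p := -q) (Or.inl (h'.pos t ht).ne')).const_mul 2))
    (fun t ht => by
      have h1 := h'.pos t ht
      have h2 := h.neg_mul_le_energy hp hg hy (a := t) (interior_subset ht).le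
      have e0 : y t ^ (2 * q + 1 + 1) = y t ^ (2 * q + 1) * y t := by
        rw [rpow_add h1, rpow_one]
      have e1 : y t ^ (-q - 1) = y t ^ (-q - 2) * y t := by
        rw [← rpow_add_one h1.ne']; ring_nf
      have e2 : y t ^ (-q - 1 - 1) = y t ^ (-q - 2) := by ring_nf
      rw [e2, e1]
      have h3 : 0 ≤ (q + 1) * g t ^ 2 + exp (2 * t) * y t ^ (2 * q + 1) * y t
          + 2 * y t * g t := by
        have h4 := mul_le_mul_of_nonneg_left h2 hp1.le
        have h5 : (2 * q + 1 + 1) * efEnergy (2 * q + 1) y g t =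
            (q + 1) * g t ^ 2 + exp (2 * t) * y t ^ (2 * q + 1) * y t := by
          rw [efEnergy, e0]; field_simp; ring
        have h6 : (2 * q + 1 + 1) * (2 / (2 * q + 1 + 1) * (y t * -g t)) = 2 * (y t * - g t) := by
          field_simp
        rw [h5, h6] at h4
        linarith
      have : 0 ≤ q * y t ^ (-q - 2) * ((q + 1) * g t ^ 2
          + exp (2 * t) * y t ^ (2 * q + 1) * y t + 2 * y t * g t) := by positivity
      linarith)
  have hlim := (((hy.rpow_const (p := -q - 1) (Or.inl hM.ne')).mul hg).const_mul (-q)).sub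
    ((hy.rpow_const (p := -q) (Or.inl hM.ne')).const_mul 2)
  have key := le_of_monotoneOn_Iio hmono hlim ha
  have hya := hpos a ha
  rcases lt_or_ge (1 + (2 * q + 1 - 1) * g a / (4 * y a)) 0 with hneg | hnn
  · exact Or.inr hneg
  left
  set w := 1 + (2 * q + 1 - 1) * g a / (4 * y a) with hw
  have e1 : y a ^ (-q) = y a ^ (-q - 1) * y a := by
    rw [← rpow_add_one hya.ne']; ring_nf
  have key2 : w * y a ^ (-q) ≤ M ^ (-q) := by
    have : w * y a ^ (-q) = y a ^ (-q) + q / 2 * (y a ^ (-q - 1) * g a) := by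
      rw [hw, e1]; field_simp; ring
    rw [this]
    simp only [mul_zero] at key
    linarith
  have key3 : M ^ q * w ≤ y a ^ q := by
    rw [rpow_neg hya.le, rpow_neg hM.le] at key2
    have hA : 0 < y a ^ q := rpow_pos_of_pos hya q
    have hB : 0 < M ^ q := rpow_pos_of_pos hM q
    rw [← div_eq_mul_inv, div_le_iff₀ hA, inv_mul_eq_div, le_div_iff₀ hB] at key2
    linarith
  have key4 := rpow_le_rpow (by positivity) key3 (inv_pos.2 hq).le
  rw [mul_rpow (by positivity) hnn, rpow_rpow_inv hM.le hq.ne', rpow_rpow_inv hya.le hq.ne'] at key4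
  have e2 : 2 / (2 * q + 1 - 1) = q⁻¹ := by field_simp; ring
  rwa [e2]

theorem exists_deriv_eq (h : IsEmdenFowler p y g (Iic T)) (hM : 0 < M)
    (hg : Tendsto g atBot (nhds 0)) (hy : Tendsto y atBot (nhds M)) (hyT : y T = 0) (hgT : g T < 0)
    {k c : ℝ} (hk : 0 < k) (hc : 0 < c) : ∃ a < T, k * g a = -c * y a := by
  have hlim : Tendsto (fun t => k * g t + c * y t) atBot (nhds (c * M)) := by
    simpa using (hg.const_mul k).add (hy.const_mul c)
  obtain ⟨b, hb, hbT⟩ := ((hlim.eventually (lt_mem_nhds (by positivity : 0 < c * M))).and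
    (eventually_lt_atBot T)).exists
  have hcont : ContinuousOn (fun t => k * g t + c * y t) (Icc b T) :=
    ((continuousOn_const.mul h.continuousOn_deriv).add
      (continuousOn_const.mul h.continuousOn)).mono Icc_subset_Iic_self
  have hT : k * g T + c * y T < 0 := by rw [hyT]; nlinarith
  obtain ⟨a, ha, ha0⟩ := intermediate_value_Icc' hbT.le hcont ⟨hT.le, hb.le⟩
  simp only at ha0
  refine ⟨a, lt_of_le_of_ne ha.2 fun haT => ?_, by linarith⟩
  rw [haT] at ha0; linarith

theorem deriv_neg_of_eq_zero (h : IsEmdenFowler p y g (Iic T)) (hyT : y T = 0) : g T < 0 := by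
  have h1 := h.pos (T - 1) (by rw [interior_Iic]; simp)
  have h2 := h.le_sub (a := T - 1) (b := T) (by simp) (by simp) (by linarith)
  nlinarith

/-- Quantitative description of a positive solution on a half line (that is, of a positive
radial solution in a disc): its height `Y` at the bubble scale, the logarithmic distance `τ` of
that scale to the boundary, and the boundary slope. -/
theorem exists_bubble (h : IsEmdenFowler p y g (Iic T)) (hp : 3 < p) (hM : 0 < M)
    (hg : Tendsto g atBot (nhds 0)) (hy : Tendsto y atBot (nhds M)) (hyT : y T = 0)
    (hp' : 3 / 4 ≤ (1 / p) ^ (2 / (p - 1))) :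
    ∃ Y τ : ℝ, 0 < Y ∧ 0 < τ ∧
      4 / p * (1 / p) ^ (2 / (p - 1)) * Y ≤ -g T ∧
      (p + 1) * -g T * (1 / 2) ^ (2 / (p - 1)) ≤ 4 * Y ∧
      -g T * (τ - 2) ≤ Y ∧ Y ≤ -g T * τ ∧
      2 * (p - 3) / (p - 1) ^ 2 ≤ exp (2 * (T - τ)) * Y ^ (p - 1) ∧
      exp (2 * (T - τ)) * Y ^ (p - 1) ≤ 8 / (p - 1) := by
  have hp1 : 1 < p := by linarith
  have hp0 : 0 < p - 1 := by linarith
  have hp2 : 0 < p + 1 := by linarith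
  have hpp : 0 < p := by linarith
  have hgT := h.deriv_neg_of_eq_zero hyT
  have hyp : ∀ {t}, t < T → 0 < y t := fun ht => h.pos _ (by rwa [interior_Iic])
  have hslope : 4 / p * (1 / p) ^ (2 / (p - 1)) * M ≤ -g T := by
    obtain ⟨a, ha, hga⟩ := h.exists_deriv_eq hM hg hy hyT hgT hp0
      (c := 4 * (1 - 1 / p)) (by
        have : 1 / p < 1 := by rw [div_lt_one hpp]; linarith
        linarith)
    have hya := hyp ha
    have e : 1 + (p - 1) * g a / (4 * y a) = 1 / p := by
      rw [hga]; field_simp; ring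
    have hb := h.bubble_le hp1 hM hg hy ha
    rw [e] at hb
    rcases hb with hb | hb
    swap
    · have : 0 < 1 / p := by positivity
      linarith
    have hm := h.antitoneOn_deriv (mem_Iic.2 ha.le) (mem_Iic.2 le_rfl) ha.le
    have e3 : g a = -(4 / p * y a) := by
      have : (p - 1) * g a = (p - 1) * -(4 / p * y a) := by
        rw [hga]; field_simp
      exact mul_left_cancel₀ hp0.ne' this
    have : 4 / p * (M * (1 / p) ^ (2 / (p - 1))) ≤ 4 / p * y a :=
      mul_le_mul_of_nonneg_left hb (by positivity)
    calc _ = 4 / p * (M * (1 / p) ^ (2 / (p - 1))) := by ring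
      _ ≤ _ := this
      _ ≤ _ := by linarith
  have hM4 : (p + 1) * -g T ≤ 4 * M := by
    have := h.energy_le_neg_mul hp1 hg hy le_rfl
    have hE : efEnergy p y g T = g T ^ 2 / 2 := by simp [efEnergy, hyT, zero_rpow hp2.ne']
    rw [hE, div_mul_eq_mul_div, le_div_iff₀ hp2] at this
    have h3 : -g T * ((p + 1) * -g T) ≤ -g T * (4 * M) := by linarith
    exact le_of_mul_le_mul_left h3 (by linarith)
  obtain ⟨a, ha, hga⟩ := h.exists_deriv_eq hM hg hy hyT hgT hp0 (c := 2) two_pos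
  have hya := hyp ha
  have hyM := h.le_limit hg hy ha.le
  have hgT0 : 0 < -g T := by linarith
  have e3 : g a = -(2 / (p - 1) * y a) := by
    have : (p - 1) * g a = (p - 1) * -(2 / (p - 1) * y a) := by
      rw [hga]; field_simp
    exact mul_left_cancel₀ hp0.ne' this
  have hYM : M * (1 / 2) ^ (2 / (p - 1)) ≤ y a := by
    have e : 1 + (p - 1) * g a / (4 * y a) = 1 / 2 := by
      rw [hga]; field_simp; ring
    have hb := h.bubble_le hp1 hM hg hy ha
    rw [e] at hb
    rcases hb with hb | hb
    · exact hb
    · norm_num at hb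
  have hhalf : 1 / 2 ≤ (1 / 2 : ℝ) ^ (2 / (p - 1)) := by
    have : (1 / 2 : ℝ) ^ (1 : ℝ) ≤ (1 / 2 : ℝ) ^ (2 / (p - 1)) :=
      rpow_le_rpow_of_exponent_ge (by norm_num) (by norm_num) (by rw [div_le_one hp0]; linarith)
    simpa using this
  have e0 : y a ^ p = y a ^ (p - 1) * y a := by
    rw [← rpow_add_one hya.ne']; ring_nf
  have e1 : y a ^ (p + 1) = y a ^ (p - 1) * y a ^ 2 := by
    rw [rpow_add_one hya.ne', e0]; ring
  refine ⟨y a, T - a, hya, sub_pos.2 ha, ?_, ?_, ?_, ?_, ?_, ?_⟩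
  · exact (mul_le_mul_of_nonneg_left hyM (by positivity)).trans hslope
  · calc _ ≤ 4 * M * (1 / 2) ^ (2 / (p - 1)) := by gcongr
      _ ≤ _ := by linarith
  · have hX := h.right_slope_le hp1 (mem_Iic.2 ha.le) (mem_Iic.2 le_rfl) ha.le hyT
      (h.deriv_nonpos hg ha.le)
    have hX0 := h.le_sub (mem_Iic.2 ha.le) (mem_Iic.2 le_rfl) ha.le
    rw [hyT] at hX0
    set D := -g T with hD
    set X := D * (T - a) - y a with hXd
    have hX0' : 0 ≤ X := by linarith
    have h1 : 3 * y a ≤ p * D := by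
      have h2 : 4 / p * (3 / 4) * y a ≤ D :=
        calc _ ≤ 4 / p * (1 / p) ^ (2 / (p - 1)) * M := by gcongr
          _ ≤ D := hslope
      have : 4 / p * (3 / 4) * y a = 3 * y a / p := by ring
      rw [this, div_le_iff₀ hpp] at h2
      linarith
    have h2 : y a / (p + 1) ≤ D - g a - 4 * y a / (p + 1) := by
      have : 2 / (p + 1) * y a ≤ -g a := by
        rw [e3, neg_neg]; gcongr; linarith
      have e5 : 3 / (p + 1) * y a ≤ D := by
        rw [div_mul_eq_mul_div, div_le_iff₀ hp2]; nlinarith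
      have e6 : 4 * y a / (p + 1) = 3 / (p + 1) * y a + y a / (p + 1) := by ring
      have e7 : 2 / (p + 1) * y a = y a / (p + 1) + y a / (p + 1) := by ring
      linarith
    have h3 : X * (y a / (p + 1)) ≤ 2 * D * (y a / (p + 1)) := by
      refine (mul_le_mul_of_nonneg_left h2 hX0').trans (hX.trans ?_)
      have : 2 * y a * (D + g a) / (p + 1) =
          2 * D * (y a / (p + 1)) + 2 * g a * (y a / (p + 1)) := by
        ring
      rw [this]
      have : 0 ≤ (-g a) * (y a / (p + 1)) :=
        mul_nonneg (by have := h.deriv_nonpos hg ha.le; linarith) (by positivity)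
      linarith
    have h4 : X ≤ 2 * D := le_of_mul_le_mul_right h3 (by positivity)
    simp only [hXd] at h4
    linarith
  · have hX0 := h.le_sub (mem_Iic.2 ha.le) (mem_Iic.2 le_rfl) ha.le
    rw [hyT] at hX0
    linarith
  · have h1 := h.neg_mul_le_energy hp1 hg hy ha.le
    rw [efEnergy, e1, e3] at h1
    have h2 : 2 * (p - 3) / (p - 1) ^ 2 * y a ^ 2 ≤ exp (2 * a) * y a ^ (p - 1) * y a ^ 2 := by
      have h3 := mul_le_mul_of_nonneg_left h1 hp2.le
      have e8 : (p + 1) * ((-(2 / (p - 1) * y a)) ^ 2 / 2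
          + exp (2 * a) * (y a ^ (p - 1) * y a ^ 2) / (p + 1)) =
          2 * (p + 1) / (p - 1) ^ 2 * y a ^ 2 + exp (2 * a) * y a ^ (p - 1) * y a ^ 2 := by
        field_simp
      have e9 : (p + 1) * (2 / (p + 1) * (y a * - -(2 / (p - 1) * y a))) =
          2 * (p - 3) / (p - 1) ^ 2 * y a ^ 2 + 2 * (p + 1) / (p - 1) ^ 2 * y a ^ 2 := by
        field_simp; ring
      rw [e8, e9] at h3
      linarith
    have := le_of_mul_le_mul_right h2 (by positivity)
    simpa using this
  · have h1 := h.energy_le_neg_mul hp1 hg hy ha.le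
    rw [efEnergy, e1, e3] at h1
    have h2 : exp (2 * a) * y a ^ (p - 1) * y a ^ 2 ≤ 8 / (p - 1) * y a ^ 2 := by
      have h3 := mul_le_mul_of_nonneg_left h1 hp2.le
      have e8 : (p + 1) * ((-(2 / (p - 1) * y a)) ^ 2 / 2
          + exp (2 * a) * (y a ^ (p - 1) * y a ^ 2) / (p + 1)) =
          2 * (p + 1) / (p - 1) ^ 2 * y a ^ 2 + exp (2 * a) * y a ^ (p - 1) * y a ^ 2 := by
        field_simp
      have e9 : (p + 1) * (2 / (p + 1) * (M * - -(2 / (p - 1) * y a))) =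
          4 / (p - 1) * y a * M := by
        field_simp; ring
      rw [e8, e9] at h3
      have : 0 ≤ 2 * (p + 1) / (p - 1) ^ 2 * y a ^ 2 := by positivity
      have h5 : M ≤ 2 * y a := by nlinarith
      have h6 : 4 / (p - 1) * y a * M ≤ 4 / (p - 1) * y a * (2 * y a) := by gcongr
      have e10 : 4 / (p - 1) * y a * (2 * y a) = 8 / (p - 1) * y a ^ 2 := by ring
      linarith
    have := le_of_mul_le_mul_right h2 (by positivity)
    simpa using this

end HalfLine

end IsEmdenFowler

/-- Inequalities satisfied by a positive Emden–Fowler solution vanishing at both ends of an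
interval `[-(L₁ + L₂), 0]`: `M` is its maximum, attained at `-L₂`, and `D₁`, `D₂` are the absolute
values of its slopes at the end points. -/
structure BumpBounds (p D₁ D₂ M L₁ L₂ : ℝ) : Prop where
  D₁_pos : 0 < D₁
  M_pos : 0 < M
  L₁_pos : 0 < L₁
  L₂_pos : 0 < L₂
  slope_le : D₁ ≤ D₂
  left_slope_le : D₁ * (L₁ - 1 / 2) ≤ M
  le_left_slope : M ≤ D₁ * L₁
  le_right_slope : M ≤ D₂ * L₂
  right_slope_le : (D₂ * L₂ - M) * (D₂ - 4 * M / (p + 1)) ≤ 2 * M * D₂ / (p + 1)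
  le_height : (p + 1) * D₁ ^ 2 ≤ 2 * M ^ 2 * (exp (-2 * L₂) * M ^ (p - 1))
  height_le : M ^ 2 * (exp (-2 * L₂) * M ^ (p - 1)) ≤ (p + 1) * D₁ ^ 2 / 2 + 2 * M * D₁
  slope_sub_le : (p + 1) * (D₂ - D₁) ≤ 4 * M
  le_slope_sub : D₂ * L₂ - M ≤ D₂ → 4 * (M - D₂) ≤ (p + 1) * (D₂ - D₁)

theorem IsEmdenFowler.bumpBounds {p T S : ℝ} {y g : ℝ → ℝ} (h : IsEmdenFowler p y g (Icc T 0))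
    (hp : 1 < p) (hTS : T < S) (hS : S < 0) (hyT : y T = 0) (hy0 : y 0 = 0) (hgS : g S = 0) :
    BumpBounds p (g T) (-g 0) (y S) (S - T) (-S) := by
  have hp2 : 0 < p + 1 := by linarith
  have hT : T ∈ Icc T 0 := left_mem_Icc.2 (by linarith)
  have h0 : (0 : ℝ) ∈ Icc T 0 := right_mem_Icc.2 (by linarith)
  have hSm : S ∈ Icc T 0 := ⟨hTS.le, hS.le⟩
  have hM : 0 < y S := h.pos S (by rw [interior_Icc]; exact ⟨hTS, hS⟩)
  have hsl := h.left_slope_le hp hT hSm hTS.le hyT hgS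
  have hls := h.sub_le hT hSm hTS.le
  have hrs := h.le_sub hSm h0 hS.le
  rw [hyT] at hls
  rw [hy0] at hrs
  have hD : 0 < g T := by
    by_contra hcon
    nlinarith
  have hrs' := h.right_slope_le hp hSm h0 hS.le hy0 hgS.le
  rw [hgS] at hrs'
  have hmax : ∀ t ∈ Icc T 0, y t ≤ y S := fun t ht => by
    rcases le_total t S with hts | hts
    · have := h.le_sub ht hSm hts
      rw [hgS] at this; linarith
    · have := h.sub_le hSm ht hts
      rw [hgS] at this; linarith
  have a1 := h.energy_sub_le hp hT hSm hTS.le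
    (m := y S) fun t ht => hmax t ⟨ht.1, ht.2.trans hS.le⟩
  have a2 := h.energy_sub_le hp hSm h0 hS.le
    (m := y S) fun t ht => hmax t ⟨hTS.le.trans ht.1, ht.2⟩
  have b1 := h.le_energy_sub hp hT hSm hTS.le (m := y S - g T * (S - T)) (c := g T)
    fun t ht => by
      have := h.sub_le (a := t) (b := S) ⟨ht.1, ht.2.trans hS.le⟩ hSm ht.2
      have h3 := h.antitoneOn_deriv hT (show t ∈ Icc T 0 from ⟨ht.1, ht.2.trans hS.le⟩) ht.1
      nlinarith [ht.2]
  have b2 := h.le_energy_sub hp hSm h0 hS.le (m := y S) (c := g 0)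
    fun t ht => by
      have htm : t ∈ Icc T 0 := ⟨hTS.le.trans ht.1, ht.2⟩
      have := h.le_sub hSm htm ht.1
      have h3 := h.antitoneOn_deriv htm h0 ht.2
      nlinarith [ht.1]
  have c1 := h.le_energy_sub hp hT hSm hTS.le (m := 0) (c := 0)
    fun t ht => by simpa using h.nonneg t ⟨ht.1, ht.2.trans hS.le⟩
  have c2 := h.le_energy_sub hp hSm h0 hS.le (m := 0) (c := 0)
    fun t ht => by simpa using h.nonneg t ⟨hTS.le.trans ht.1, ht.2⟩
  have hET : efEnergy p y g T = g T ^ 2 / 2 := by simp [efEnergy, hyT, zero_rpow hp2.ne']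
  have hE0 : efEnergy p y g 0 = g 0 ^ 2 / 2 := by simp [efEnergy, hy0, zero_rpow hp2.ne']
  have hES : efEnergy p y g S = y S ^ 2 * (exp (-2 * -S) * y S ^ (p - 1)) / (p + 1) := by
    have e : y S ^ (p + 1) = y S ^ (p - 1) * y S ^ 2 := by
      rw [← rpow_natCast, ← rpow_add hM]; norm_num; ring_nf
    rw [efEnergy, hgS, e, neg_mul_neg]; ring
  have hg0 : g 0 < 0 := by
    by_contra hcon
    nlinarith
  rw [hET, hES, hgS] at a1 b1 c1
  rw [hE0, hES, hgS] at a2 b2 c2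
  set Q := y S ^ 2 * (exp (-2 * -S) * y S ^ (p - 1)) with hQ
  rw [hyT] at b1 c1
  rw [hy0] at b2 c2
  have a1' : Q - (p + 1) * (g T) ^ 2 / 2 ≤ 2 * (y S * g T) := by
    have := mul_le_mul_of_nonneg_left a1 hp2.le
    field_simp at this ⊢
    linarith
  have a2' : (p + 1) * (g 0) ^ 2 / 2 - Q ≤ 2 * (y S * -g 0) := by
    have := mul_le_mul_of_nonneg_left a2 hp2.le
    field_simp at this ⊢
    linarith
  have b1' : 2 * ((y S - g T * (S - T)) * g T + g T * y S) ≤ Q - (p + 1) * (g T) ^ 2 / 2 := by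
    have := mul_le_mul_of_nonneg_left b1 hp2.le
    field_simp at this ⊢
    linarith
  have b2' : 2 * (y S * -g 0 + g 0 * (-y S + g 0 * S)) ≤ (p + 1) * (g 0) ^ 2 / 2 - Q := by
    have := mul_le_mul_of_nonneg_left b2 hp2.le
    field_simp at this ⊢
    linarith
  have c1' : 0 ≤ Q - (p + 1) * (g T) ^ 2 / 2 := by
    have := mul_le_mul_of_nonneg_left c1 hp2.le
    field_simp at this ⊢
    linarith
  have c2' : 0 ≤ (p + 1) * (g 0) ^ 2 / 2 - Q := by
    have := mul_le_mul_of_nonneg_left c2 hp2.le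
    field_simp at this ⊢
    linarith
  have hle : g T ≤ -g 0 := by
    have : (p + 1) * (g T) ^ 2 ≤ (p + 1) * (-g 0) ^ 2 := by linarith
    exact le_of_sq_le_sq (le_of_mul_le_mul_left this hp2) (by linarith)
  refine ⟨hD, hM, by linarith, by linarith, hle, hsl, by linarith, by linarith, ?_, by linarith,
    by linarith, ?_, ?_⟩
  · convert hrs' using 2 <;> ring
  · have : (p + 1) * (-g 0 - g T) * (-g 0 + g T) ≤ 4 * y S * (-g 0 + g T) := by linarith
    exact le_of_mul_le_mul_right this (by linarith)
  · intro hX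
    have k1 : g T * (g T * (S - T) - y S) ≤ g T * (g T / 2) :=
      mul_le_mul_of_nonneg_left (by linarith) hD.le
    have k2 : -g 0 * (-g 0 * -S - y S) ≤ -g 0 * -g 0 :=
      mul_le_mul_of_nonneg_left hX (by linarith)
    have k3 : g T * g T ≤ g T * -g 0 := mul_le_mul_of_nonneg_left hle hD.le
    have : 4 * (y S - -g 0) * (-g 0 + g T) ≤ (p + 1) * (-g 0 - g T) * (-g 0 + g T) := by
      nlinarith
    exact le_of_mul_le_mul_right this (by linarith)

theorem tendsto_log_div_sub_one : Tendsto (fun p : ℝ => log p / (p - 1)) atTop (nhds 0) := by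
  simpa [sub_eq_add_neg] using tendsto_pow_log_div_mul_add_atTop 1 (-1) 1 one_ne_zero

theorem tendsto_const_div_sub_one (c : ℝ) : Tendsto (fun p : ℝ => c / (p - 1)) atTop (nhds 0) :=
  tendsto_const_nhds.div_atTop (tendsto_atTop_add_const_right _ _ tendsto_id)

theorem tendsto_inv_rpow_div_sub_one :
    Tendsto (fun p : ℝ => (1 / p) ^ (2 / (p - 1))) atTop (nhds 1) := by
  have h := (tendsto_log_div_sub_one.const_mul (-2)).rexp
  rw [mul_zero, exp_zero] at h
  refine h.congr' ?_
  filter_upwards [eventually_gt_atTop 1] with p hp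
  rw [rpow_def_of_pos (by positivity), one_div, log_inv]
  ring_nf

theorem tendsto_half_rpow_div_sub_one :
    Tendsto (fun p : ℝ => (1 / 2 : ℝ) ^ (2 / (p - 1))) atTop (nhds 1) := by
  have := (tendsto_const_nhds (x := (1 / 2 : ℝ))).rpow (tendsto_const_div_sub_one 2)
    (Or.inl (by norm_num))
  simpa using this

theorem tendsto_div_add_const (c : ℝ) : Tendsto (fun p : ℝ => p / (p + c)) atTop (nhds 1) := by
  have h : Tendsto (fun p : ℝ => c / (p + c)) atTop (nhds 0) :=
    tendsto_const_nhds.div_atTop (tendsto_atTop_add_const_right _ _ tendsto_id)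
  have h2 := h.const_sub 1
  rw [sub_zero] at h2
  refine h2.congr' ?_
  filter_upwards [eventually_gt_atTop (-c)] with p hp
  have : p + c ≠ 0 := by linarith
  field_simp
  ring

/-- If `x e^{2x}` converges to `x₀ e^{2x₀}` with `x > 0`, then `x` converges to `x₀`. -/
theorem tendsto_of_tendsto_mul_exp {x : ℝ → ℝ} {x₀ : ℝ} (hx₀ : 0 < x₀)
    (hx : ∀ᶠ p in atTop, 0 < x p)
    (h : Tendsto (fun p => x p * exp (2 * x p)) atTop (nhds (x₀ * exp (2 * x₀)))) :
    Tendsto x atTop (nhds x₀) := by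
  have hmono : ∀ {a b : ℝ}, 0 ≤ a → a ≤ b → a * exp (2 * a) ≤ b * exp (2 * b) := by
    intro a b ha hab
    gcongr
    linarith
  have hstrict : ∀ {a b : ℝ}, 0 ≤ a → a < b → a * exp (2 * a) < b * exp (2 * b) := by
    intro a b ha hab
    have : exp (2 * a) ≤ exp (2 * b) := exp_le_exp.2 (by linarith)
    have h2 : 0 < exp (2 * b) := exp_pos _
    nlinarith
  refine tendsto_order.2 ⟨fun a ha => ?_, fun b hb => ?_⟩
  · rcases lt_or_ge a 0 with ha0 | ha0
    · filter_upwards [hx] with p hp using ha0.trans hp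
    · filter_upwards [h.eventually (lt_mem_nhds (hstrict ha0 ha)), hx] with p hp hp0
      by_contra hcon
      exact absurd (hmono hp0.le (not_lt.1 hcon)) (not_le.2 hp)
  · filter_upwards [h.eventually (gt_mem_nhds (hstrict hx₀.le hb))] with p hp
    by_contra hcon
    exact absurd (hmono (hx₀.trans hb).le (not_lt.1 hcon)) (not_le.2 hp)

/-- The rescaled boundary slope of the positive radial solution in a disc converges
to `4√e`. -/
theorem tendsto_disc_slope {D T : ℝ → ℝ} (h : ∀ᶠ p in atTop, ∃ Y τ : ℝ, 0 < Y ∧ 0 < τ ∧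
      4 / p * (1 / p) ^ (2 / (p - 1)) * Y ≤ D p ∧
      (p + 1) * D p * (1 / 2) ^ (2 / (p - 1)) ≤ 4 * Y ∧
      D p * (τ - 2) ≤ Y ∧ Y ≤ D p * τ ∧
      2 * (p - 3) / (p - 1) ^ 2 ≤ exp (2 * (T p - τ)) * Y ^ (p - 1) ∧
      exp (2 * (T p - τ)) * Y ^ (p - 1) ≤ 8 / (p - 1)) :
    Tendsto (fun p => p * D p * exp (2 * T p / (p - 1))) atTop (nhds (4 * √(exp 1))) := by
  obtain ⟨N, hN⟩ := eventually_atTop.1 h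
  choose! Y τ hYτ using hN
  have hev : ∀ᶠ p : ℝ in atTop, N ≤ p ∧ 10 ≤ p :=
    (eventually_ge_atTop N).and (eventually_ge_atTop 10)
  have hq : Tendsto (fun p => p * D p / Y p) atTop (nhds 4) := by
    have hl := tendsto_inv_rpow_div_sub_one.const_mul 4
    have hu := ((tendsto_half_rpow_div_sub_one.inv₀ one_ne_zero).const_mul 4).mul
      (tendsto_div_add_const 1)
    simp only [inv_one, mul_one] at hl hu
    refine tendsto_of_tendsto_of_tendsto_of_le_of_le' hl hu ?_ ?_
    · filter_upwards [hev] with p ⟨hp, hp10⟩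
      obtain ⟨hY, hτ, h1, -⟩ := hYτ p hp
      have hp0 : 0 < p := by linarith
      rw [le_div_iff₀ hY]
      calc _ = p * (4 / p * (1 / p) ^ (2 / (p - 1)) * Y p) := by field_simp
        _ ≤ _ := by gcongr
    · filter_upwards [hev] with p ⟨hp, hp10⟩
      obtain ⟨hY, hτ, -, h1, -⟩ := hYτ p hp
      have hp0 : 0 < p := by linarith
      have hc : 0 < (1 / 2 : ℝ) ^ (2 / (p - 1)) := by positivity
      set c := (1 / 2 : ℝ) ^ (2 / (p - 1))
      rw [div_le_iff₀ hY, ← div_eq_mul_inv, div_mul_div_comm, div_mul_eq_mul_div,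
        le_div_iff₀ (by positivity)]
      nlinarith
  have hqi : Tendsto (fun p => Y p / (p * D p)) atTop (nhds (1 / 4)) := by
    have := hq.inv₀ (by norm_num)
    simpa [one_div] using this
  have hτp : Tendsto (fun p => τ p / p) atTop (nhds (1 / 4)) := by
    have h2 : Tendsto (fun p : ℝ => 2 / p) atTop (nhds 0) :=
      tendsto_const_nhds.div_atTop tendsto_id
    have hu := hqi.add h2
    rw [add_zero] at hu
    refine tendsto_of_tendsto_of_tendsto_of_le_of_le' hqi hu ?_ ?_
    all_goals
      filter_upwards [hev] with p ⟨hp, hp10⟩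
      obtain ⟨hY, hτ, -, -, h1, h2, -⟩ := hYτ p hp
      have hp0 : 0 < p := by linarith
      have hD : 0 < D p := by
        by_contra hcon
        nlinarith
    · rw [div_le_div_iff₀ (by positivity) hp0]
      nlinarith
    · rw [div_add_div _ _ (by positivity) hp0.ne', div_le_div_iff₀ hp0 (by positivity)]
      have : p * p * (D p * (τ p - 2)) ≤ p * p * Y p := by gcongr
      linarith
  have hr : Tendsto (fun p => (2 * (T p - τ p) + (p - 1) * log (Y p)) / (p - 1)) atTop
      (nhds 0) := by
    have hl := tendsto_log_div_sub_one.neg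
    rw [neg_zero] at hl
    refine tendsto_of_tendsto_of_tendsto_of_le_of_le' hl tendsto_const_nhds ?_ ?_
    all_goals
      filter_upwards [hev] with p ⟨hp, hp10⟩
      obtain ⟨hY, hτ, -, -, -, -, h1, h2⟩ := hYτ p hp
      have hp0 : 0 < p := by linarith
      have hp1 : 0 < p - 1 := by linarith
      have hlog : log (exp (2 * (T p - τ p)) * Y p ^ (p - 1)) =
          2 * (T p - τ p) + (p - 1) * log (Y p) := by
        rw [log_mul (exp_pos _).ne' (by positivity), log_exp, log_rpow hY]
      rw [← hlog]
    · rw [← neg_div, ← log_inv]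
      gcongr
      refine le_trans ?_ h1
      rw [inv_eq_one_div, div_le_div_iff₀ hp0 (by positivity)]
      nlinarith
    · refine div_nonpos_of_nonpos_of_nonneg (log_nonpos (by positivity) (h2.trans ?_)) hp1.le
      rw [div_le_one hp1]; linarith
  have hlog := ((hτp.const_mul 2).mul ((tendsto_div_add_const (-1)))).add hr
  have hfin := hq.mul hlog.rexp
  have e : (4 : ℝ) * exp (2 * (1 / 4) * 1 + 0) = 4 * √(exp 1) := by
    rw [← exp_half]; norm_num
  rw [e] at hfin
  refine hfin.congr' ?_
  filter_upwards [hev] with p ⟨hp, hp10⟩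
  obtain ⟨hY, hτ, -⟩ := hYτ p hp
  have hp0 : 0 < p := by linarith
  have hp1 : p - 1 ≠ 0 := by linarith
  have e1 : 2 * (τ p / p) * (p / (p + -1)) + (2 * (T p - τ p) + (p - 1) * log (Y p)) / (p - 1) =
      log (Y p) + 2 * T p / (p - 1) := by
    rw [← sub_eq_add_neg]
    field_simp
    ring
  rw [e1, exp_add, exp_log hY]
  field_simp

namespace BumpBounds

variable {p D₁ D₂ M L₁ L₂ : ℝ}

theorem height_eq (h : BumpBounds p D₁ D₂ M L₁ L₂) (hp : 1 < p) :
    M = exp (2 * L₂ / (p - 1)) * exp (log (exp (-2 * L₂) * M ^ (p - 1)) / (p - 1)) := by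
  have hM := h.M_pos
  have hp1 : p - 1 ≠ 0 := by linarith
  rw [log_mul (exp_pos _).ne' (by positivity), log_exp, log_rpow hM, ← exp_add]
  have : 2 * L₂ / (p - 1) + (-2 * L₂ + (p - 1) * log M) / (p - 1) = log M := by
    field_simp; ring
  rw [this, exp_log hM]

theorem height_le_of_le (h : BumpBounds p D₁ D₂ M L₁ L₂) (hp : 5 ≤ p) (hD : D₁ ≤ M) :
    exp (-2 * L₂) * M ^ (p - 1) ≤ p := by
  have h1 := h.height_le
  have hM := h.M_pos
  have hD0 := h.D₁_pos
  have h2 : M ^ 2 * (exp (-2 * L₂) * M ^ (p - 1)) ≤ M ^ 2 * p := by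
    refine h1.trans ?_
    have h3 : D₁ ^ 2 ≤ M ^ 2 := by gcongr
    have h4 : M * D₁ ≤ M ^ 2 := by nlinarith
    nlinarith [sq_nonneg M]
  exact le_of_mul_le_mul_left h2 (by positivity)

theorem left_le (h : BumpBounds p D₁ D₂ M L₁ L₂) (hp : 12 ≤ p)
    (hκ : exp (log p / (p - 1)) <
      p * D₁ * exp (-2 * (L₁ + L₂) / (p - 1)) * (1 / 6 - 1 / (2 * p))) : L₁ ≤ p / 6 := by
  by_contra! hcon
  have hD := h.D₁_pos
  have hp1 : 0 < p - 1 := by linarith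
  have hM := h.M_pos
  have hDM : D₁ ≤ M := by nlinarith [h.left_slope_le]
  have hΓ := h.height_le_of_le (by linarith) hDM
  have hMe := h.height_eq (by linarith)
  have hΓ0 : 0 < exp (-2 * L₂) * M ^ (p - 1) := by positivity
  set Γ := exp (-2 * L₂) * M ^ (p - 1) with hΓd
  have h1 : M ≤ exp (2 * L₂ / (p - 1)) * exp (log p / (p - 1)) := by
    calc M = _ := hMe
      _ ≤ _ := by gcongr
  have h2 : exp (-2 * (L₁ + L₂) / (p - 1)) ≤ exp (-(2 * L₂ / (p - 1))) := by
    rw [exp_le_exp, ← neg_div]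
    gcongr
    linarith [h.L₁_pos]
  have h3 : p * D₁ * (1 / 6 - 1 / (2 * p)) ≤ M := by
    have e : p * D₁ * (1 / 6 - 1 / (2 * p)) = D₁ * (p / 6 - 1 / 2) := by field_simp
    rw [e]
    exact le_trans (by gcongr) h.left_slope_le
  have h4 : p * D₁ * exp (-2 * (L₁ + L₂) / (p - 1)) * (1 / 6 - 1 / (2 * p)) ≤
      exp (log p / (p - 1)) := by
    calc _ = (p * D₁ * (1 / 6 - 1 / (2 * p))) * exp (-2 * (L₁ + L₂) / (p - 1)) := by ring
      _ ≤ M * exp (-(2 * L₂ / (p - 1))) := by gcongr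
      _ ≤ exp (2 * L₂ / (p - 1)) * exp (log p / (p - 1)) * exp (-(2 * L₂ / (p - 1))) := by
        gcongr
      _ = _ := by rw [exp_neg]; field_simp
  linarith

theorem right_deficit_le (h : BumpBounds p D₁ D₂ M L₁ L₂) (hp : 12 ≤ p) (hL : L₁ ≤ p / 6) :
    D₂ * L₂ - M ≤ D₂ := by
  have hM := h.M_pos
  have hD := h.D₁_pos
  have hp2 : 0 < p + 1 := by linarith
  have h1 : 6 * M ≤ D₂ * p := by
    have : D₁ * L₁ ≤ D₂ * (p / 6) := by
      have := h.L₁_pos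
      have := h.slope_le
      have : 0 ≤ D₂ := by linarith
      gcongr
    linarith [h.le_left_slope]
  have h2 : 2 * M / (p + 1) ≤ D₂ - 4 * M / (p + 1) := by
    have : 6 * M / (p + 1) ≤ D₂ := by
      rw [div_le_iff₀ hp2]; nlinarith [h.slope_le]
    have e : 6 * M / (p + 1) = 2 * M / (p + 1) + 4 * M / (p + 1) := by ring
    linarith
  have h3 : 0 ≤ D₂ * L₂ - M := by linarith [h.le_right_slope]
  have h4 : (D₂ * L₂ - M) * (2 * M / (p + 1)) ≤ D₂ * (2 * M / (p + 1)) := by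
    refine (mul_le_mul_of_nonneg_left h2 h3).trans (h.right_slope_le.trans (le_of_eq ?_))
    ring
  exact le_of_mul_le_mul_right h4 (by positivity)

theorem inv_le_height (h : BumpBounds p D₁ D₂ M L₁ L₂) (hp : 12 ≤ p) (hL : L₁ ≤ p / 6) :
    1 / p ≤ exp (-2 * L₂) * M ^ (p - 1) := by
  have hM := h.M_pos
  have hD := h.D₁_pos
  have h1 := h.le_height
  have h2 : M ≤ D₁ * (p / 6) := h.le_left_slope.trans (by gcongr)
  have hΓ0 : 0 < exp (-2 * L₂) * M ^ (p - 1) := by positivity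
  set Γ := exp (-2 * L₂) * M ^ (p - 1) with hΓd
  have h3 : M ^ 2 ≤ (D₁ * (p / 6)) ^ 2 := by gcongr
  have h4 : D₁ ^ 2 * (p + 1) ≤ D₁ ^ 2 * (p ^ 2 / 18 * Γ) := by
    have : 2 * M ^ 2 * Γ ≤ 2 * (D₁ * (p / 6)) ^ 2 * Γ := by gcongr
    nlinarith
  have h5 := le_of_mul_le_mul_left h4 (by positivity)
  rw [div_le_iff₀ (by linarith)]
  nlinarith

theorem le_left (h : BumpBounds p D₁ D₂ M L₁ L₂) (hp : 12 ≤ p) (hL : L₁ ≤ p / 6)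
    (hκ : p * D₁ * exp (-2 * (L₁ + L₂) / (p - 1)) ≤ 8)
    (he : 1 / 2 ≤ exp (-(log p / (p - 1)))) : p / 48 ≤ L₁ := by
  have hp1 : 0 < p - 1 := by linarith
  have hp0 : 0 < p := by linarith
  have hM := h.M_pos
  have hD := h.D₁_pos
  have hL0 := h.L₁_pos
  have hMe := h.height_eq (by linarith)
  have hΓ := h.inv_le_height hp hL
  have hΓ0 : 0 < exp (-2 * L₂) * M ^ (p - 1) := by positivity
  set Γ := exp (-2 * L₂) * M ^ (p - 1) with hΓd
  have h1 : exp (2 * L₂ / (p - 1)) * (1 / 2) ≤ M := by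
    calc _ ≤ exp (2 * L₂ / (p - 1)) * exp (-(log p / (p - 1))) := by gcongr
      _ ≤ exp (2 * L₂ / (p - 1)) * exp (log Γ / (p - 1)) := by
        rw [← neg_div, ← log_inv, inv_eq_one_div]
        gcongr
      _ = M := hMe.symm
  have h2 : exp (2 * L₁ / (p - 1)) ≤ 3 := by
    have : exp (2 * L₁ / (p - 1)) ≤ exp 1 := by
      rw [exp_le_exp, div_le_one hp1]; linarith
    linarith [exp_one_lt_d9]
  have e : exp (-2 * (L₁ + L₂) / (p - 1)) * exp (2 * L₁ / (p - 1)) *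
      exp (2 * L₂ / (p - 1)) = 1 := by
    rw [← exp_add, ← exp_add, ← exp_zero]; ring_nf
  have h3 : p * (1 / 2) ≤ 24 * L₁ := by
    have h4 : exp (2 * L₂ / (p - 1)) * (p * (1 / 2)) ≤ exp (2 * L₂ / (p - 1)) * (24 * L₁) := by
      calc _ = p * (exp (2 * L₂ / (p - 1)) * (1 / 2)) := by ring
        _ ≤ p * (D₁ * L₁) := mul_le_mul_of_nonneg_left (h1.trans h.le_left_slope) hp0.le
        _ = p * (D₁ * L₁) * (exp (-2 * (L₁ + L₂) / (p - 1)) * exp (2 * L₁ / (p - 1)) *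
              exp (2 * L₂ / (p - 1))) := by rw [e, mul_one]
        _ = (p * D₁ * exp (-2 * (L₁ + L₂) / (p - 1))) * exp (2 * L₁ / (p - 1)) * L₁ *
              exp (2 * L₂ / (p - 1)) := by ring
        _ ≤ 8 * 3 * L₁ * exp (2 * L₂ / (p - 1)) := by gcongr
        _ = _ := by ring
    exact le_of_mul_le_mul_left h4 (exp_pos _)
  linarith

theorem tendsto_exp_length {D₁ D₂ M L₁ L₂ : ℝ → ℝ} {x₀ : ℝ} (hx₀ : 0 < x₀)
    (hx₀e : x₀ * exp (2 * x₀) = 1 / (4 * √(exp 1)))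
    (h : ∀ᶠ p in atTop, BumpBounds p (D₁ p) (D₂ p) (M p) (L₁ p) (L₂ p))
    (hκ : Tendsto (fun p => p * D₁ p * exp (-2 * (L₁ p + L₂ p) / (p - 1))) atTop
      (nhds (4 * √(exp 1)))) :
    Tendsto (fun p => exp (-2 * (L₁ p + L₂ p) / (p - 1))) atTop
      (nhds (exp (-2 * (x₀ + 1 / (4 + 1 / x₀))))) := by
  have hsq : 3 / 2 < √(exp 1) := by
    rw [lt_sqrt (by norm_num)]; linarith [exp_one_gt_d9]
  have hsq' : √(exp 1) < 2 := by
    rw [sqrt_lt' (by norm_num)]; linarith [exp_one_lt_d9]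
  have hlog := tendsto_log_div_sub_one
  have hlogneg := hlog.neg
  rw [neg_zero] at hlogneg
  have hinv : Tendsto (fun p : ℝ => 1 / 6 - 1 / (2 * p)) atTop (nhds (1 / 6)) := by
    have : Tendsto (fun p : ℝ => 1 / (2 * p)) atTop (nhds 0) :=
      tendsto_const_nhds.div_atTop (tendsto_id.const_mul_atTop two_pos)
    have := this.const_sub (1 / 6)
    rwa [sub_zero] at this
  have hlt : ∀ᶠ p : ℝ in atTop, exp (log p / (p - 1)) <
      p * D₁ p * exp (-2 * (L₁ p + L₂ p) / (p - 1)) * (1 / 6 - 1 / (2 * p)) :=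
    hlog.rexp.eventually_lt (hκ.mul hinv) (by rw [exp_zero]; linarith)
  have h8 := hκ.eventually (gt_mem_nhds (show 4 * √(exp 1) < 8 by linarith))
  have hhalf := hlogneg.rexp.eventually (lt_mem_nhds (show 1 / 2 < exp 0 by norm_num))
  have hev : ∀ᶠ p in atTop, BumpBounds p (D₁ p) (D₂ p) (M p) (L₁ p) (L₂ p) ∧ 96 ≤ p ∧
      L₁ p ≤ p / 6 ∧ p / 48 ≤ L₁ p := by
    filter_upwards [h, hlt, h8, hhalf, eventually_ge_atTop 96] with p hp h1 h2 h3 h4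
    have h5 := hp.left_le (by linarith) h1
    exact ⟨hp, h4, h5, hp.le_left (by linarith) h5 h2.le h3.le⟩
  have hDM : ∀ᶠ p in atTop, D₁ p / M p ≤ 1 / (p / 48 - 1 / 2) := by
    filter_upwards [hev] with p ⟨hp, h96, _, hL⟩
    rw [div_le_div_iff₀ hp.M_pos (by linarith), one_mul]
    refine le_trans ?_ hp.left_slope_le
    have := hp.D₁_pos
    gcongr
  have hDM0 : Tendsto (fun p => D₁ p / M p) atTop (nhds 0) := by
    have : Tendsto (fun p : ℝ => 1 / (p / 48 - 1 / 2)) atTop (nhds 0) :=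
      tendsto_const_nhds.div_atTop (by
        simp only [sub_eq_add_neg]
        exact tendsto_atTop_add_const_right _ _ (tendsto_id.atTop_div_const (by norm_num)))
    refine tendsto_of_tendsto_of_tendsto_of_le_of_le' tendsto_const_nhds this ?_ hDM
    filter_upwards [h] with p hp using (div_pos hp.D₁_pos hp.M_pos).le
  have hΓ : Tendsto (fun p => log (exp (-2 * L₂ p) * M p ^ (p - 1)) / (p - 1)) atTop
      (nhds 0) := by
    refine tendsto_of_tendsto_of_tendsto_of_le_of_le' hlogneg hlog ?_ ?_
    · filter_upwards [hev] with p ⟨hp, h96, hL, _⟩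
      have := hp.inv_le_height (by linarith) hL
      have hp1 : 0 < p - 1 := by linarith
      rw [← neg_div, ← log_inv, inv_eq_one_div]
      gcongr
    · filter_upwards [hev] with p ⟨hp, h96, _, hL⟩
      have hM := hp.M_pos
      have hp1 : 0 < p - 1 := by linarith
      have := hp.height_le_of_le (by linarith) (by
        nlinarith [hp.left_slope_le, hp.D₁_pos])
      gcongr
  have hρ : Tendsto (fun p => D₁ p * L₁ p / M p) atTop (nhds 1) := by
    have hu := (hDM0.div_const 2).const_add 1
    rw [zero_div, add_zero] at hu
    refine tendsto_of_tendsto_of_tendsto_of_le_of_le' tendsto_const_nhds hu ?_ ?_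
    · filter_upwards [h] with p hp
      rw [one_le_div hp.M_pos]; exact hp.le_left_slope
    · filter_upwards [h] with p hp
      have hM := hp.M_pos
      have e : 1 + D₁ p / M p / 2 = (M p + D₁ p / 2) / M p := by field_simp
      rw [e]
      gcongr
      linarith [hp.left_slope_le]
  have hx : Tendsto (fun p => L₁ p / p) atTop (nhds x₀) := by
    refine tendsto_of_tendsto_mul_exp hx₀ ?_ ?_
    · filter_upwards [h, eventually_gt_atTop 0] with p hp hp0 using div_pos hp.L₁_pos hp0
    · have hsmall : Tendsto (fun p => -2 * (L₁ p / p) / (p - 1)) atTop (nhds 0) := by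
        refine tendsto_of_tendsto_of_tendsto_of_le_of_le' (tendsto_const_div_sub_one (-1))
          tendsto_const_nhds ?_ ?_
        · filter_upwards [hev] with p ⟨hp, h96, hL, _⟩
          have hp1 : 0 < p - 1 := by linarith
          have : L₁ p / p ≤ 1 / 6 := by rw [div_le_iff₀ (by linarith)]; linarith
          gcongr
          linarith
        · filter_upwards [hev] with p ⟨hp, h96, hL, _⟩
          have := hp.L₁_pos
          refine div_nonpos_of_nonpos_of_nonneg ?_ (by linarith)
          have : 0 < L₁ p / p := div_pos this (by linarith)
          linarith
      have hlim := (hρ.div hκ (by positivity)).mul (hΓ.add hsmall).rexp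
      rw [add_zero, exp_zero, mul_one, ← hx₀e] at hlim
      refine hlim.congr' ?_
      filter_upwards [hev] with p ⟨hp, h96, _⟩
      have hMe := hp.height_eq (by linarith)
      have hM := hp.M_pos
      have hD := hp.D₁_pos
      set lam := log (exp (-2 * L₂ p) * M p ^ (p - 1)) / (p - 1)
      have hp1 : p - 1 ≠ 0 := by linarith
      have hp0 : p ≠ 0 := by linarith
      have key : exp (lam + -2 * (L₁ p / p) / (p - 1)) = exp (2 * (L₁ p / p)) *
          (exp (-2 * (L₁ p + L₂ p) / (p - 1)) * M p) := by
        have : exp (-2 * (L₁ p + L₂ p) / (p - 1)) * M p =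
          exp (-2 * (L₁ p + L₂ p) / (p - 1)) * (exp (2 * L₂ p / (p - 1)) * exp lam) := by
          rw [← hMe]
        rw [this, ← exp_add, ← exp_add, ← exp_add]
        congr 1
        field_simp
        ring
      simp only [Pi.div_apply]
      rw [key]
      have := exp_pos (-2 * (L₁ p + L₂ p) / (p - 1))
      generalize exp (-2 * (L₁ p + L₂ p) / (p - 1)) = E at *
      field_simp
  have hd1 : Tendsto (fun p => (p + 1) * D₁ p / M p) atTop (nhds (1 / x₀)) := by
    have := (hρ.div hx hx₀.ne').add hDM0
    rw [add_zero] at this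
    refine this.congr' ?_
    filter_upwards [hev] with p ⟨hp, h96, _⟩
    have hM := hp.M_pos
    have hL := hp.L₁_pos
    simp only [Pi.div_apply]
    field_simp
  have hd2 : Tendsto (fun p => (p + 1) * D₂ p / M p) atTop (nhds (4 + 1 / x₀)) := by
    have hu := hd1.const_add 4
    have hl := hu.mul (tendsto_div_add_const 4 |>.comp
      (tendsto_atTop_add_const_right atTop (1 : ℝ) tendsto_id))
    rw [mul_one] at hl
    refine tendsto_of_tendsto_of_tendsto_of_le_of_le' hl hu ?_ ?_
    · filter_upwards [hev] with p ⟨hp, h96, hL, _⟩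
      have hM := hp.M_pos
      have h1 := hp.le_slope_sub (hp.right_deficit_le (by linarith) hL)
      have e : 4 + (p + 1) * D₁ p / M p = (4 * M p + (p + 1) * D₁ p) / M p := by field_simp
      simp only [Function.comp, id]
      rw [e, div_mul_div_comm, div_le_div_iff₀ (mul_pos hM (by linarith)) hM]
      have : (4 * M p + (p + 1) * D₁ p) * ((p + 1) * M p) ≤
          ((p + 1 + 4) * D₂ p) * ((p + 1) * M p) := by
        have hp2 : 0 < p + 1 := by linarith
        gcongr
        linarith
      linarith
    · filter_upwards [hev] with p ⟨hp, h96, hL, _⟩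
      have hM := hp.M_pos
      have e : 4 + (p + 1) * D₁ p / M p = (4 * M p + (p + 1) * D₁ p) / M p := by field_simp
      rw [e]
      gcongr
      linarith [hp.slope_sub_le]
  have hpos : 0 < 4 + 1 / x₀ := by positivity
  have hD2M : Tendsto (fun p => D₂ p / M p) atTop (nhds 0) := by
    have := hd2.div_atTop (tendsto_atTop_add_const_right atTop (1 : ℝ) tendsto_id)
    refine this.congr' ?_
    filter_upwards [hev] with p ⟨hp, h96, _⟩
    simp only [id]
    have : p + 1 ≠ 0 := by linarith
    field_simp
  have hρ2 : Tendsto (fun p => D₂ p * L₂ p / M p) atTop (nhds 1) := by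
    have hu := hD2M.const_add 1
    rw [add_zero] at hu
    refine tendsto_of_tendsto_of_tendsto_of_le_of_le' tendsto_const_nhds hu ?_ ?_
    · filter_upwards [h] with p hp
      rw [one_le_div hp.M_pos]; exact hp.le_right_slope
    · filter_upwards [hev] with p ⟨hp, h96, hL, _⟩
      have hM := hp.M_pos
      have e : 1 + D₂ p / M p = (M p + D₂ p) / M p := by field_simp
      rw [e]
      gcongr
      linarith [hp.right_deficit_le (by linarith) hL]
  have hL2 := hρ2.div hd2 hpos.ne'
  have hratio : Tendsto (fun p : ℝ => (p + 1) / (p + -1)) atTop (nhds 1) := by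
    have := (tendsto_div_add_const (-1)).div (tendsto_div_add_const 1) one_ne_zero
    rw [div_one] at this
    refine this.congr' ?_
    filter_upwards [eventually_gt_atTop 1] with p hp
    simp only [Pi.div_apply]
    have : p + -1 ≠ 0 := by linarith
    field_simp
  have hfin := (((hx.mul (tendsto_div_add_const (-1))).add (hL2.mul hratio)).const_mul (-2)).rexp
  rw [mul_one, mul_one] at hfin
  refine hfin.congr' ?_
  filter_upwards [hev] with p ⟨hp, h96, _⟩
  have hM := hp.M_pos
  have hD : 0 < D₂ p := hp.D₁_pos.trans_le hp.slope_le
  have hp1 : p - 1 ≠ 0 := by linarith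
  have hp2 : p + 1 ≠ 0 := by linarith
  have hp0 : p ≠ 0 := by linarith
  simp only [Pi.div_apply, ← sub_eq_add_neg]
  congr 1
  field_simp

end BumpBounds

theorem hasDerivAt_derivWithin_Icc {v : ℝ → ℝ} (hv : ContDiffOn ℝ 2 v (Icc 0 1)) {r : ℝ}
    (hr : r ∈ Ioo (0 : ℝ) 1) : HasDerivAt v (derivWithin v (Icc 0 1) r) r := by
  have hn : Icc (0 : ℝ) 1 ∈ nhds r := Icc_mem_nhds hr.1 hr.2
  rw [derivWithin_of_mem_nhds hn]
  exact ((hv.contDiffAt hn).differentiableAt two_ne_zero).hasDerivAt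

theorem contDiffOn_derivWithin_Icc {v : ℝ → ℝ} (hv : ContDiffOn ℝ 2 v (Icc 0 1)) :
    ContDiffOn ℝ 1 (derivWithin v (Icc 0 1)) (Icc 0 1) :=
  hv.derivWithin (uniqueDiffOn_Icc zero_lt_one) (by norm_num)

theorem hasDerivAt_derivWithin_derivWithin_Icc {v : ℝ → ℝ} (hv : ContDiffOn ℝ 2 v (Icc 0 1))
    {r : ℝ} (hr : r ∈ Ioo (0 : ℝ) 1) :
    HasDerivAt (derivWithin v (Icc 0 1)) (deriv (deriv v) r) r := by
  have hn : Icc (0 : ℝ) 1 ∈ nhds r := Icc_mem_nhds hr.1 hr.2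
  have h1 := ((contDiffOn_derivWithin_Icc hv).contDiffAt hn).differentiableAt one_ne_zero
  have he : derivWithin v (Icc 0 1) =ᶠ[nhds r] deriv v := by
    filter_upwards [Ioo_mem_nhds hr.1 hr.2] with x hx
    exact derivWithin_of_mem_nhds (Icc_mem_nhds hx.1 hx.2)
  rw [← he.deriv_eq]
  exact h1.hasDerivAt

/-- In the variable `t = log r`, a radial solution of the Lane–Emden equation becomes an
Emden–Fowler solution. -/
theorem isEmdenFowler_of_radial {p : ℝ} {v : ℝ → ℝ} {s : Set ℝ}
    (hv : ContDiffOn ℝ 2 v (Icc 0 1))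
    (hode : ∀ r ∈ Ioo (0 : ℝ) 1, -deriv (deriv v) r - deriv v r / r = |v r| ^ (p - 1) * v r)
    (hs : Convex ℝ s) (hs0 : s ⊆ Iic 0) (hnn : ∀ t ∈ s, 0 ≤ v (exp t))
    (hpos : ∀ t ∈ interior s, 0 < v (exp t)) :
    IsEmdenFowler p (fun t => v (exp t))
      (fun t => exp t * derivWithin v (Icc 0 1) (exp t)) s := by
  have hmaps : MapsTo exp s (Icc 0 1) := fun t ht =>
    ⟨(exp_pos t).le, exp_le_one_iff.2 (hs0 ht)⟩
  have hmem : ∀ t ∈ interior s, exp t ∈ Ioo (0 : ℝ) 1 := fun t ht => by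
    have : t ∈ interior (Iic (0 : ℝ)) := interior_mono hs0 ht
    rw [interior_Iic] at this
    exact ⟨exp_pos t, exp_lt_one_iff.2 this⟩
  refine ⟨hs, hv.continuousOn.comp continuous_exp.continuousOn hmaps,
    continuous_exp.continuousOn.mul
      ((contDiffOn_derivWithin_Icc hv).continuousOn.comp continuous_exp.continuousOn hmaps),
    fun t ht => ?_, fun t ht => ?_, hnn, hpos⟩
  · have := (hasDerivAt_derivWithin_Icc hv (hmem t ht)).comp t (Real.hasDerivAt_exp t)
    rwa [mul_comm] at this
  · have h1 := (hasDerivAt_derivWithin_derivWithin_Icc hv (hmem t ht)).comp t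
      (Real.hasDerivAt_exp t)
    refine ((Real.hasDerivAt_exp t).mul h1).congr_deriv ?_
    have h2 := hode _ (hmem t ht)
    have h3 := (hasDerivAt_derivWithin_Icc hv (hmem t ht)).deriv
    have hp := hpos t ht
    rw [h3, abs_of_pos hp, ← rpow_add_one hp.ne', sub_add_cancel] at h2
    have he : exp (2 * t) = exp t * exp t := by rw [← exp_add]; ring_nf
    have h4 : deriv (deriv v) (exp t) =
        -(v (exp t) ^ p) - derivWithin v (Icc 0 1) (exp t) / exp t := by linarith
    rw [he]
    simp only [Function.comp, h4]
    have := (exp_pos t).ne'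
    field_simp
    ring

namespace LaneEmdenFamily

variable (F : LaneEmdenFamily)

/-- The slope at the nodal circle of the profile, in the variable `log r`. -/
def nodeSlope (p : ℝ) : ℝ :=
  exp (log (F.rp p)) * derivWithin (F.u p) (Icc 0 1) (exp (log (F.rp p)))

theorem bumpBounds {p : ℝ} (hp : 1 < p) :
    BumpBounds p (F.nodeSlope p)
      (-(exp 0 * derivWithin (F.u p) (Icc 0 1) (exp 0))) (F.u p (exp (log (F.sp p))))
      (log (F.sp p) - log (F.rp p)) (-log (F.sp p)) := by
  have hr := F.rp_mem p hp
  have hs := F.sp_mem p hp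
  have hs0 : 0 < F.sp p := hr.1.trans hs.1
  have hEF := isEmdenFowler_of_radial (s := Icc (log (F.rp p)) 0) (F.smooth p hp) (F.ode p hp)
    (convex_Icc _ _) Icc_subset_Iic_self
    (fun t ht => by
      rcases eq_or_lt_of_le ht.1 with h | h
      · rw [← h, exp_log hr.1, F.rp_zero p hp]
      rcases eq_or_lt_of_le ht.2 with h' | h'
      · rw [h', exp_zero, F.boundary p hp]
      · exact (F.pos_out p hp _ ⟨(log_lt_iff_lt_exp hr.1).1 h, exp_lt_one_iff.2 h'⟩).le)
    (fun t ht => by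
      rw [interior_Icc] at ht
      exact F.pos_out p hp _ ⟨(log_lt_iff_lt_exp hr.1).1 ht.1, exp_lt_one_iff.2 ht.2⟩)
  refine hEF.bumpBounds hp (log_lt_log hr.1 hs.1) (log_neg hs0 hs.2) ?_ ?_ ?_
  · simp only [exp_log hr.1, F.rp_zero p hp]
  · simp only [exp_zero, F.boundary p hp]
  · have hmem : F.sp p ∈ Ioo (0 : ℝ) 1 := ⟨hs0, hs.2⟩
    have hmax : IsLocalMax (F.u p) (F.sp p) := by
      filter_upwards [Icc_mem_nhds hmem.1 hmem.2] with x hx using F.sp_max p hp x hx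
    simp only [exp_log hs0,
      hmax.hasDerivAt_eq_zero (hasDerivAt_derivWithin_Icc (F.smooth p hp) hmem), mul_zero]

theorem tendsto_nodeSlope :
    Tendsto (fun p => p * F.nodeSlope p * exp (2 * log (F.rp p) / (p - 1))) atTop
      (nhds (4 * √(exp 1))) := by
  refine tendsto_disc_slope ?_
  filter_upwards [eventually_gt_atTop 3,
    tendsto_inv_rpow_div_sub_one.eventually (lt_mem_nhds (show (3 / 4 : ℝ) < 1 by norm_num))]
    with p hp3 hp'
  have hp : 1 < p := by linarith
  have hr := F.rp_mem p hp
  have hlt : ∀ t < log (F.rp p), F.u p (exp t) < 0 := fun t ht =>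
    F.neg_in p hp _ ⟨(exp_pos t).le, (lt_log_iff_exp_lt hr.1).1 ht⟩
  have hsm : ContDiffOn ℝ 2 (fun r => -F.u p r) (Icc 0 1) := (F.smooth p hp).neg
  have hdw : derivWithin (fun r => -F.u p r) (Icc 0 1) =
      fun r => -derivWithin (F.u p) (Icc 0 1) r := by
    funext r
    exact derivWithin.fun_neg
  have hEF := isEmdenFowler_of_radial (p := p) (s := Iic (log (F.rp p))) hsm
    (fun r hr => by
      have h1 := F.ode p hp r hr
      have h2 : deriv (fun r => -F.u p r) = fun r => -deriv (F.u p) r := by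
        funext r; exact deriv.fun_neg
      rw [h2, deriv.fun_neg, abs_neg]
      beta_reduce
      rw [neg_div]
      linarith)
    (convex_Iic _) (Iic_subset_Iic.2 (log_neg hr.1 hr.2).le)
    (fun t ht => by
      rcases eq_or_lt_of_le (mem_Iic.1 ht) with h | h
      · rw [h, exp_log hr.1, F.rp_zero p hp, neg_zero]
      · exact (neg_pos.2 (hlt t h)).le)
    (fun t ht => by
      rw [interior_Iic] at ht
      exact neg_pos.2 (hlt t ht))
  have hexp : Tendsto exp atBot (nhdsWithin 0 (Icc 0 1)) :=
    tendsto_nhdsWithin_iff.2 ⟨tendsto_exp_atBot, (eventually_le_atBot 0).mono fun t ht =>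
      ⟨(exp_pos t).le, exp_le_one_iff.2 ht⟩⟩
  have h0 : (0 : ℝ) ∈ Icc (0 : ℝ) 1 := by simp
  have hy := Tendsto.comp (hsm.continuousOn 0 h0) hexp
  have hg := tendsto_exp_atBot.mul
    (Tendsto.comp ((contDiffOn_derivWithin_Icc hsm).continuousOn 0 h0) hexp)
  rw [zero_mul] at hg
  have := hEF.exists_bubble hp3 (neg_pos.2 (F.center_neg p hp)) hg hy
    (by simp only [exp_log hr.1, F.rp_zero p hp, neg_zero]) hp'.le
  simpa only [hdw, mul_neg, neg_neg, nodeSlope] using this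

end LaneEmdenFamily

theorem existsUnique_root :
    ∃! t : ℝ, 0 < t ∧ 2 * √(exp 1) * log t + t = 0 := by
  have hs : 1 < √(exp 1) := by
    rw [lt_sqrt (by norm_num)]; linarith [exp_one_gt_d9]
  have hcont : ContinuousOn (fun t : ℝ => 2 * √(exp 1) * log t + t) (Icc (exp (-1)) 1) :=
    (continuousOn_const.mul (continuousOn_log.mono fun t ht =>
      ((exp_pos _).trans_le ht.1).ne')).add continuousOn_id
  have he : exp (-1) < 1 := exp_lt_one_iff.2 (by norm_num)
  obtain ⟨t, ht, h0⟩ := intermediate_value_Icc he.le hcont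
    (show (0 : ℝ) ∈ Icc _ _ from ⟨by rw [log_exp]; linarith, by simp⟩)
  refine ⟨t, ⟨(exp_pos _).trans_le ht.1, h0⟩, ?_⟩
  have hmono : ∀ {a b : ℝ}, 0 < a → a < b →
      2 * √(exp 1) * log a + a < 2 * √(exp 1) * log b + b := by
    intro a b ha hab
    have := log_lt_log ha hab
    gcongr
  rintro b ⟨hb, hb0⟩
  simp only at h0
  rcases lt_trichotomy b t with h | h | h
  · have := hmono hb h
    linarith
  · exact h
  · have := hmono ((exp_pos _).trans_le ht.1) h
    linarith

/-- As `p → +∞` one has `r_p^{2/(p−1)} → t̄/e^{t̄/(2(t̄+√e))}`,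
where `t̄` is the unique positive root of `2√e·log t + t = 0`. -/
theorem nodal_radius_rate (F : LaneEmdenFamily) :
    (∃! t : ℝ, 0 < t ∧ 2 * Real.sqrt (Real.exp 1) * Real.log t + t = 0) ∧
    ∀ t : ℝ, 0 < t → 2 * Real.sqrt (Real.exp 1) * Real.log t + t = 0 →
      Tendsto (fun p => F.rp p ^ (2 / (p - 1))) atTop
        (nhds (t / Real.exp (t / (2 * (t + Real.sqrt (Real.exp 1)))))) := by
  refine ⟨existsUnique_root, fun t ht hroot => ?_⟩
  have hs : 0 < √(exp 1) := by positivity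
  have hlog : log t = -2 * (t / (4 * √(exp 1))) := by
    field_simp
    linarith
  have htexp : t = exp (-2 * (t / (4 * √(exp 1)))) := by rw [← hlog, exp_log ht]
  have hexp (p : ℝ) : -2 * (log (F.sp p) - log (F.rp p) + -log (F.sp p)) / (p - 1) =
      2 * log (F.rp p) / (p - 1) := by ring
  have hx₀e : t / (4 * √(exp 1)) * exp (2 * (t / (4 * √(exp 1)))) = 1 / (4 * √(exp 1)) := by
    have : t * exp (2 * (t / (4 * √(exp 1)))) = 1 := by
      nth_rewrite 1 [htexp]
      rw [← exp_add, ← exp_zero]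
      ring_nf
    rw [div_mul_eq_mul_div, this]
  have h := BumpBounds.tendsto_exp_length (x₀ := t / (4 * √(exp 1))) (by positivity) hx₀e
    ((eventually_gt_atTop 1).mono fun p hp => F.bumpBounds hp)
    (by simpa only [hexp] using F.tendsto_nodeSlope)
  have hlim : exp (-2 * (t / (4 * √(exp 1)) + 1 / (4 + 1 / (t / (4 * √(exp 1)))))) =
      t / exp (t / (2 * (t + √(exp 1)))) := by
    rw [mul_add, exp_add, ← htexp,
      div_eq_mul_inv t (exp (t / (2 * (t + √(exp 1))))), ← exp_neg]
    congr 2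
    field_simp
    ring
  rw [hlim] at h
  refine h.congr' ?_
  filter_upwards [eventually_gt_atTop 1] with p hp
  rw [hexp, rpow_def_of_pos (F.rp_mem p hp).1]
  ring_nf
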